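/- There exists an origin-symmetric convex body K in ℝ⁵ that is not an intersection body: no finite non-negative Borel measure μ on the unit sphere S⁴ ⊂ ℝ⁵ satisfies ∫_{S⁴} ρ_K(x) f(x) dx = ∫_{S⁴} ( ∫_{S⁴ ∩ ξ^⊥} f(x) dx ) dμ(ξ) for every continuous function f on S⁴. -/

import Mathlib

open MeasureTheory Set
open scoped RealInnerProductSpace ENNReal


abbrev EE (n : ℕ) := EuclideanSpace ℝ (Fin n)

lemma aux_normalize {n : ℕ} (x y : EE n) (hx : 1 ≤ ‖x‖) (hy : 1 ≤ ‖y‖) :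
    ‖‖x‖⁻¹ • x - ‖y‖⁻¹ • y‖ ≤ 2 * ‖x - y‖ := by
  have hx0 : 0 < ‖x‖ := by linarith
  have hy0 : 0 < ‖y‖ := by linarith
  have e : ‖x‖⁻¹ • x - ‖y‖⁻¹ • y = ‖x‖⁻¹ • ((x - y) + (‖y‖ - ‖x‖) • (‖y‖⁻¹ • y)) := by
    rw [smul_add, smul_smul, smul_smul, smul_sub]
    have : ‖x‖⁻¹ * (‖y‖ - ‖x‖) * ‖y‖⁻¹ = ‖x‖⁻¹ - ‖y‖⁻¹ := by field_simp
    rw [this, sub_smul]; abel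
  rw [e, norm_smul, norm_inv, norm_norm]
  have h1 : ‖(x - y) + (‖y‖ - ‖x‖) • (‖y‖⁻¹ • y)‖ ≤ ‖x - y‖ + ‖x - y‖ := by
    refine (norm_add_le _ _).trans ?_
    gcongr
    rw [norm_smul, norm_smul, norm_inv, norm_norm, inv_mul_cancel₀ hy0.ne', mul_one,
      Real.norm_eq_abs, norm_sub_rev x y]
    exact abs_norm_sub_norm_le y x
  have h2 : ‖x‖⁻¹ ≤ 1 := inv_le_one_of_one_le₀ hx
  have h3 : 0 ≤ ‖x‖⁻¹ := by positivity
  nlinarith [norm_nonneg (x - y), norm_nonneg ((x - y) + (‖y‖ - ‖x‖) • (‖y‖⁻¹ • y))]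

lemma aux_toLp {n : ℕ} (y : Fin n → ℝ) : ‖(WithLp.toLp 2 y : EE n)‖ ≤ Real.sqrt n * ‖y‖ := by
  rw [EuclideanSpace.norm_eq]
  apply Real.sqrt_le_iff.2
  refine ⟨by positivity, ?_⟩
  rw [mul_pow, Real.sq_sqrt (by positivity)]
  calc ∑ i, ‖y i‖ ^ 2 ≤ ∑ i : Fin n, ‖y‖ ^ 2 := by
        gcongr with i; exact norm_le_pi_norm y i
    _ = n * ‖y‖ ^ 2 := by simp

noncomputable def facet {n : ℕ} (i : Fin (n+1)) (s : ℝ) (y : Fin n → ℝ) : EE (n+1) :=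
  WithLp.toLp 2 (Fin.insertNth i s y)

lemma facet_sub {n : ℕ} (i : Fin (n+1)) (s : ℝ) (y z : Fin n → ℝ) :
    ‖facet i s y - facet i s z‖ = ‖(WithLp.toLp 2 (y - z) : EE n)‖ := by
  rw [EuclideanSpace.norm_eq, EuclideanSpace.norm_eq]
  congr 1
  rw [Fin.sum_univ_succAbove _ i]
  simp [facet]

lemma facet_norm {n : ℕ} (i : Fin (n+1)) (s : ℝ) (hs : s = 1 ∨ s = -1) (y : Fin n → ℝ) :
    1 ≤ ‖facet i s y‖ := by
  have h := PiLp.norm_apply_le (facet i s y) i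
  have : ‖(facet i s y) i‖ = 1 := by
    rcases hs with rfl | rfl <;> simp [facet]
  linarith

lemma sphere_fin (n : ℕ) :
    (μH[(n:ℝ)] : Measure (EE (n+1))) (Metric.sphere (0 : EE (n+1)) 1) < ∞ := by
  let P : Fin (n+1) × Bool → Set (EE (n+1)) := fun p =>
    (fun y => ‖facet p.1 (if p.2 then 1 else -1) y‖⁻¹ • facet p.1 (if p.2 then 1 else -1) y) ''
      (Metric.closedBall (0 : Fin n → ℝ) 1)
  have hcov : Metric.sphere (0 : EE (n+1)) 1 ⊆ ⋃ p, P p := by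
    intro x hx
    have hx1 : ‖x‖ = 1 := by simpa using hx
    obtain ⟨i, -, hi⟩ := Finset.exists_max_image (Finset.univ : Finset (Fin (n+1)))
      (fun i => |x i|) ⟨0, Finset.mem_univ _⟩
    have hxi : 0 < |x i| := by
      by_contra hcon
      have : x = 0 := by
        ext j
        have := hi j (Finset.mem_univ _)
        have h2 : |x j| ≤ 0 := by linarith
        simpa using h2
      rw [this] at hx1; simp at hx1
    rw [mem_iUnion]
    refine ⟨(i, decide (0 < x i)), (fun j => |x i|⁻¹ * x (i.succAbove j)), ?_, ?_⟩
    · rw [mem_closedBall_zero_iff, pi_norm_le_iff_of_nonneg zero_le_one]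
      intro j
      rw [norm_mul, norm_inv, Real.norm_eq_abs, Real.norm_eq_abs, abs_abs, inv_mul_le_one₀ hxi]
      exact hi _ (Finset.mem_univ _)
    · have e : facet i (if (decide (0 < x i)) = true then 1 else -1)
          (fun j => |x i|⁻¹ * x (i.succAbove j)) = |x i|⁻¹ • x := by
        ext k
        refine Fin.succAboveCases i ?_ (fun j => ?_) k
        · simp only [facet, Fin.insertNth_apply_same, decide_eq_true_eq, PiLp.smul_apply, smul_eq_mul]
          split_ifs with h
          · rw [abs_of_pos h]; field_simp
          · have h' : x i < 0 := lt_of_le_of_ne (not_lt.1 h) (abs_pos.1 hxi)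
            rw [abs_of_neg h', inv_neg, neg_mul, inv_mul_cancel₀ h'.ne]
        · simp [facet]
      show ‖facet i _ _‖⁻¹ • facet i _ _ = x
      rw [e, norm_smul, hx1, smul_smul, norm_inv, Real.norm_eq_abs, abs_abs, mul_one, inv_inv,
        mul_inv_cancel₀ hxi.ne', one_smul]
  refine (measure_mono hcov).trans_lt ((measure_iUnion_le _).trans_lt ?_)
  rw [tsum_fintype]
  refine ENNReal.sum_lt_top.2 fun p _ => ?_
  have hs : (if p.2 then (1:ℝ) else -1) = 1 ∨ (if p.2 then (1:ℝ) else -1) = -1 := by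
    cases p.2 <;> simp
  have hl : LipschitzWith (Real.toNNReal (2 * Real.sqrt n))
    (fun y => ‖facet p.1 (if p.2 then 1 else -1) y‖⁻¹ • facet p.1 (if p.2 then 1 else -1) y) := by
    apply LipschitzWith.of_dist_le_mul
    intro y z
    rw [dist_eq_norm, dist_eq_norm, Real.coe_toNNReal _ (by positivity)]
    refine (aux_normalize _ _ (facet_norm _ _ hs _) (facet_norm _ _ hs _)).trans ?_
    rw [facet_sub]
    have := aux_toLp (y - z)
    linarith
  refine (hl.hausdorffMeasure_image_le (by positivity) _).trans_lt ?_
  refine ENNReal.mul_lt_top (by simp) ?_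
  have := hausdorffMeasure_pi_real (ι := Fin n)
  rw [Fintype.card_fin] at this
  rw [this]
  exact measure_closedBall_lt_top

lemma sphere_pos (n : ℕ) :
    0 < (μH[(n:ℝ)] : Measure (EE (n+1))) (Metric.sphere (0 : EE (n+1)) 1) := by
  have hl : LipschitzWith 1 (fun x : EE (n+1) => (fun j : Fin n => x j.succ)) := by
    apply LipschitzWith.of_dist_le_mul
    intro y z
    rw [NNReal.coe_one, one_mul, dist_eq_norm, dist_eq_norm, pi_norm_le_iff_of_nonneg (norm_nonneg _)]
    intro j
    exact PiLp.norm_apply_le (y - z) j.succ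
  have h := hl.hausdorffMeasure_image_le (d := (n:ℝ)) (by positivity) (Metric.sphere (0 : EE (n+1)) 1)
  have h3 := hausdorffMeasure_pi_real (ι := Fin n)
  rw [Fintype.card_fin] at h3
  rw [h3] at h
  simp only [ENNReal.coe_one, ENNReal.one_rpow, one_mul] at h
  refine lt_of_lt_of_le ?_ h
  have hr : 0 < 1 / (Real.sqrt n + 1) := by positivity
  refine lt_of_lt_of_le (Metric.measure_ball_pos volume (0 : Fin n → ℝ) hr) (measure_mono ?_)
  intro y hy
  rw [mem_ball_zero_iff] at hy
  have hy2 : ‖(WithLp.toLp 2 y : EE n)‖ ≤ 1 := by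
    refine (aux_toLp y).trans ?_
    have : Real.sqrt n * ‖y‖ ≤ (Real.sqrt n + 1) * (1 / (Real.sqrt n + 1)) := by
      gcongr; linarith
    rwa [mul_one_div_cancel (by positivity)] at this
  have hy3 : ∑ i, y i ^ 2 ≤ 1 := by
    rw [EuclideanSpace.norm_eq] at hy2
    simpa using hy2
  refine ⟨WithLp.toLp 2 (Fin.cons (Real.sqrt (1 - ∑ i, y i ^ 2)) y), ?_, ?_⟩
  · rw [mem_sphere_zero_iff_norm, EuclideanSpace.norm_eq, Fin.sum_univ_succ]
    simp [Real.sq_sqrt (sub_nonneg.2 hy3)]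
  · funext j; simp

section moments
variable {n : ℕ} {d : ℝ}

lemma intOn (hfin : (μH[d] : Measure (EE n)) (Metric.sphere (0 : EE n) 1) < ∞) (g : EE n → ℝ)
    (hg : Continuous g) : IntegrableOn g (Metric.sphere (0 : EE n) 1) μH[d] := by
  obtain ⟨C, hC⟩ := (isCompact_sphere (0 : EE n) 1).exists_bound_of_continuousOn hg.continuousOn
  exact IntegrableOn.of_bound hfin hg.aestronglyMeasurable C
    ((ae_restrict_iff' Metric.isClosed_sphere.measurableSet).2 (Filter.Eventually.of_forall hC))

lemma mom_inv (v w : EE n) (h : ‖v‖ = ‖w‖) (k : ℕ) :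
    ∫ x in Metric.sphere (0 : EE n) 1, ⟪x, v⟫ ^ k ∂μH[d]
      = ∫ x in Metric.sphere (0 : EE n) 1, ⟪x, w⟫ ^ k ∂μH[d] := by
  let e : EE n ≃ₗᵢ[ℝ] EE n := (ℝ ∙ (v - w))ᗮ.reflection
  have he : e v = w := Submodule.reflection_sub h
  have hmp := (e.toIsometryEquiv.measurePreserving_hausdorffMeasure d)
  have := hmp.setIntegral_preimage_emb e.toIsometryEquiv.toHomeomorph.measurableEmbedding
    (fun x => ⟪x, w⟫ ^ k) (Metric.sphere (0 : EE n) 1)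
  rw [← this]
  have hpre : e.toIsometryEquiv ⁻¹' (Metric.sphere (0 : EE n) 1) = Metric.sphere (0 : EE n) 1 := by
    ext x; simp
  rw [hpre]
  congr 1
  funext x
  rw [← he]
  simp

lemma mom_coord (i : Fin n) (w : EE n) (k : ℕ) :
    ∫ x in Metric.sphere (0 : EE n) 1, ⟪x, w⟫ ^ k ∂μH[d]
      = ‖w‖ ^ k * ∫ x in Metric.sphere (0 : EE n) 1, (x i) ^ k ∂μH[d] := by
  rw [mom_inv w (‖w‖ • EuclideanSpace.single i (1:ℝ)) (by simp [norm_smul]) k, ← integral_const_mul]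
  congr 1
  funext x
  rw [inner_smul_right, mul_pow, EuclideanSpace.inner_single_right]
  simp

lemma mom_cross (hfin : (μH[d] : Measure (EE n)) (Metric.sphere (0 : EE n) 1) < ∞)
    (i j : Fin n) (hij : i ≠ j) (k : ℕ) :
    (2 * k + 1) * ∫ x in Metric.sphere (0 : EE n) 1, (x i) ^ (2 * k) * (x j) ^ 2 ∂μH[d]
      = ∫ x in Metric.sphere (0 : EE n) 1, (x i) ^ (2 * k + 2) ∂μH[d] := by
  set S := Metric.sphere (0 : EE n) 1
  set M := ∫ x in S, (x i) ^ (2 * k + 2) ∂μH[d]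
  set c : ℕ → ℝ := fun m => ∫ x in S, (x j) ^ m * (x i) ^ (2 * k + 2 - m) ∂μH[d] with hc
  let p : Polynomial ℝ := ∑ m ∈ Finset.range (2 * k + 2 + 1),
    Polynomial.monomial m (c m * ((2 * k + 2).choose m : ℝ))
  let q : Polynomial ℝ := Polynomial.C M * (1 + Polynomial.X ^ 2) ^ (k + 1)
  have hpq : p = q := by
    apply Polynomial.funext
    intro b
    have h1 := mom_coord (d := d) i
      (b • EuclideanSpace.single j (1:ℝ) + EuclideanSpace.single i (1:ℝ)) (2 * k + 2)
    have h2 : ‖b • EuclideanSpace.single j (1:ℝ) + EuclideanSpace.single i (1:ℝ)‖ ^ 2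
        = 1 + b ^ 2 := by
      rw [norm_add_sq_real, norm_smul, inner_smul_left, EuclideanSpace.inner_single_right]
      simp [hij]
      ring
    have h3 : ‖b • EuclideanSpace.single j (1:ℝ) + EuclideanSpace.single i (1:ℝ)‖ ^ (2 * k + 2)
        = (1 + b ^ 2) ^ (k + 1) := by
      rw [← h2, ← pow_mul]; ring_nf
    rw [h3] at h1
    have h4 : ∀ x : EE n, ⟪x, b • EuclideanSpace.single j (1:ℝ) + EuclideanSpace.single i (1:ℝ)⟫
        ^ (2 * k + 2) = ∑ m ∈ Finset.range (2 * k + 2 + 1),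
          ((2 * k + 2).choose m : ℝ) * b ^ m * ((x j) ^ m * (x i) ^ (2 * k + 2 - m)) := by
      intro x
      rw [inner_add_right, inner_smul_right]
      simp only [EuclideanSpace.inner_single_right, one_mul, conj_trivial]
      rw [add_pow]
      refine Finset.sum_congr rfl fun m _ => ?_
      ring
    simp_rw [h4] at h1
    rw [integral_finsetSum] at h1
    · simp only [p, q, Polynomial.eval_finsetSum, Polynomial.eval_monomial, Polynomial.eval_mul,
        Polynomial.eval_C, Polynomial.eval_pow, Polynomial.eval_add, Polynomial.eval_one,
        Polynomial.eval_X]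
      rw [mul_comm M, ← h1]
      refine Finset.sum_congr rfl fun m _ => ?_
      rw [integral_const_mul]
      ring
    · intro m _
      exact intOn hfin _ (by fun_prop)
  have h2 := congrArg (fun r => Polynomial.coeff r 2) hpq
  have hq : q.coeff 2 = M * (k + 1) := by
    have : q = Polynomial.C M * Polynomial.expand ℝ 2 ((1 + Polynomial.X) ^ (k + 1)) := by
      simp [q]
    rw [this, Polynomial.coeff_C_mul]
    have := Polynomial.coeff_expand_mul (p := 2) (by norm_num)
      ((1 + Polynomial.X : Polynomial ℝ) ^ (k + 1)) 1
    rw [one_mul] at this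
    rw [this, Polynomial.coeff_one_add_X_pow]
    simp
  have hp : p.coeff 2 = c 2 * ((2 * k + 2).choose 2 : ℝ) := by
    simp only [p, Polynomial.finsetSum_coeff, Polynomial.coeff_monomial]
    rw [Finset.sum_ite_eq']
    simp
  simp only [hp, hq] at h2
  have hch : ((2 * k + 2).choose 2 : ℝ) = (k + 1) * (2 * k + 1) := by
    rw [Nat.cast_choose_two]; push_cast; ring
  rw [hch] at h2
  have hk : (k : ℝ) + 1 ≠ 0 := by positivity
  have h5 : c 2 = ∫ x in S, (x i) ^ (2 * k) * (x j) ^ 2 ∂μH[d] := by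
    simp only [hc]
    congr 1
    funext x
    rw [mul_comm]; congr 2
  rw [← h5]
  apply mul_left_cancel₀ hk
  linarith

lemma mom_rec (hfin : (μH[d] : Measure (EE n)) (Metric.sphere (0 : EE n) 1) < ∞)
    (i : Fin n) (k : ℕ) :
    (2 * k + n) * ∫ x in Metric.sphere (0 : EE n) 1, (x i) ^ (2 * k + 2) ∂μH[d]
      = (2 * k + 1) * ∫ x in Metric.sphere (0 : EE n) 1, (x i) ^ (2 * k) ∂μH[d] := by
  have h : ∫ x in Metric.sphere (0 : EE n) 1, (x i) ^ (2 * k) ∂μH[d]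
      = ∑ j, ∫ x in Metric.sphere (0 : EE n) 1, (x i) ^ (2 * k) * (x j) ^ 2 ∂μH[d] := by
    rw [← integral_finsetSum]
    · refine setIntegral_congr_fun Metric.isClosed_sphere.measurableSet fun x hx => ?_
      have hx1 : ‖x‖ = 1 := by simpa using hx
      have : ∑ j, x j ^ 2 = 1 := by
        have := EuclideanSpace.real_norm_sq_eq x
        rw [← this, hx1]; norm_num
      simp only [← Finset.mul_sum, this, mul_one]
    · intro j _
      exact intOn hfin _ (by fun_prop)
  rw [h, ← Finset.add_sum_erase _ _ (Finset.mem_univ i), mul_add, Finset.mul_sum,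
    Finset.sum_congr rfl (fun j hj => mom_cross hfin i j (Finset.ne_of_mem_erase hj).symm k)]
  have hn : 1 ≤ n := by have := i.2; omega
  simp only [Finset.sum_const, Finset.card_erase_of_mem (Finset.mem_univ i), Finset.card_univ,
    Fintype.card_fin, nsmul_eq_mul, ← pow_add]
  push_cast [hn]
  ring

end moments

noncomputable def NN (y : ℝ) : ℝ :=
  501/500 - 751/100*y + 46/10*y^2 - 83/100*y^3 + 966/100*y^4 - 16*y^5 + 1216/100*y^6

noncomputable def ph (y : ℝ) : ℝ := 1 - 8*y + 8*y^2

lemma c1 (z : ℝ) (h1 : (11/25) ≤ z) (h2 : z ≤ (3/4)) : ph (1 - z^2) ≤ z * NN (1 - z^2) := by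
  obtain ⟨u, hu⟩ : ∃ u, u = z - (11/25) := ⟨_, rfl⟩
  obtain ⟨v, hv⟩ : ∃ v, v = (3/4) - z := ⟨_, rfl⟩
  have hu0 : 0 ≤ u := by linarith
  have hv0 : 0 ≤ v := by linarith
  have h : 0 ≤ (44508210621226430272372736/610438657436126064775) * (u^0 * v^13) +
      (25341406844603234533769216/24417546297445042591) * (u^1 * v^12) +
      (140735352905491305752166400/24417546297445042591) * (u^2 * v^11) +
      (420728465977814284533760000/24417546297445042591) * (u^3 * v^10) +
      (760578184211887611904000000/24417546297445042591) * (u^4 * v^9) +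
      (866938947204736243200000000/24417546297445042591) * (u^5 * v^8) +
      (620278828149741080000000000/24417546297445042591) * (u^6 * v^7) +
      (265508565457358250000000000/24417546297445042591) * (u^7 * v^6) +
      (65035585241090625000000000/24417546297445042591) * (u^8 * v^5) +
      (17614667538457031250000000/24417546297445042591) * (u^9 * v^4) +
      (12563829658203125000000000/24417546297445042591) * (u^10 * v^3) +
      (6138745361328125000000000/24417546297445042591) * (u^11 * v^2) +
      (1428130157470703125000000/24417546297445042591) * (u^12 * v^1) +
      (129737281799316406250000/24417546297445042591) * (u^13 * v^0) := by positivity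
  rw [hu, hv] at h
  unfold NN ph
  linarith

lemma c2 (z : ℝ) (h1 : (3/4) ≤ z) (h2 : z ≤ 1) : ph (1 - z^2) ≤ z * NN (1 - z^2) := by
  obtain ⟨u, hu⟩ : ∃ u, u = z - (3/4) := ⟨_, rfl⟩
  obtain ⟨v, hv⟩ : ∃ v, v = 1 - z := ⟨_, rfl⟩
  have hu0 : 0 ≤ u := by linarith
  have hv0 : 0 ≤ v := by linarith
  have h : 0 ≤ (10883152/125) * (u^0 * v^13) +
      (31793088/25) * (u^1 * v^12) +
      (1010727424/125) * (u^2 * v^11) +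
      (3642538496/125) * (u^3 * v^10) +
      (1663318144/25) * (u^4 * v^9) +
      (13054293504/125) * (u^5 * v^8) +
      (3114722304/25) * (u^6 * v^7) +
      (15859355648/125) * (u^7 * v^6) +
      (14182612992/125) * (u^8 * v^5) +
      (1984954368/25) * (u^9 * v^4) +
      (4632870912/125) * (u^10 * v^3) +
      (248512512/25) * (u^11 * v^2) +
      (171966464/125) * (u^12 * v^1) +
      (16777216/125) * (u^13 * v^0) := by positivity
  rw [hu, hv] at h
  unfold NN ph
  linarith

lemma c3 (z : ℝ) (h1 : (89/100) ≤ z) (h2 : z ≤ (23/25)) : 2 * ph (z^2) ≤ z * NN (z^2) := by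
  obtain ⟨u, hu⟩ : ∃ u, u = z - (89/100) := ⟨_, rfl⟩
  obtain ⟨v, hv⟩ : ∃ v, v = (23/25) - z := ⟨_, rfl⟩
  have hu0 : 0 ≤ u := by linarith
  have hv0 : 0 ≤ v := by linarith
  have h : 0 ≤ (42538668532437384482021392/13286025) * (u^0 * v^13) +
      (464261294050351953651793088/13286025) * (u^1 * v^12) +
      (763871576620823109648291328/4428675) * (u^2 * v^11) +
      (6741624790802329208296436224/13286025) * (u^3 * v^10) +
      (2620140433070123691096247936/2657205) * (u^4 * v^9) +
      (1954180646254178691433604608/1476225) * (u^5 * v^8) +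
      (5512145249762954292638544896/4428675) * (u^6 * v^7) +
      (3588076013052692557080383488/4428675) * (u^7 * v^6) +
      (516656772663470754544009216/1476225) * (u^8 * v^5) +
      (242702666722605763981672448/2657205) * (u^9 * v^4) +
      (162287135218743199806783488/13286025) * (u^10 * v^3) +
      (6947160830836911451930624/4428675) * (u^11 * v^2) +
      (10943873215115732803649536/13286025) * (u^12 * v^1) +
      (2338519035577160135868416/13286025) * (u^13 * v^0) := by positivity
  rw [hu, hv] at h
  unfold NN ph
  linarith

lemma c4 (z : ℝ) (h1 : (23/25) ≤ z) (h2 : z ≤ 1) : 2 * ph (z^2) ≤ z * NN (z^2) := by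
  obtain ⟨u, hu⟩ : ∃ u, u = z - (23/25) := ⟨_, rfl⟩
  obtain ⟨v, hv⟩ : ∃ v, v = 1 - z := ⟨_, rfl⟩
  have hu0 : 0 ≤ u := by linarith
  have hv0 : 0 ≤ v := by linarith
  have h : 0 ≤ (418159789248197103/819200) * (u^0 * v^13) +
      (588553515354652493/32768) * (u^1 * v^12) +
      (4707998999808514325/16384) * (u^2 * v^11) +
      (35672445087923991875/16384) * (u^3 * v^10) +
      (313566140888878953125/32768) * (u^4 * v^9) +
      (895493917401637109375/32768) * (u^5 * v^8) +
      (441780299808662109375/8192) * (u^6 * v^7) +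
      (622054716535400390625/8192) * (u^7 * v^6) +
      (2531422485504150390625/32768) * (u^8 * v^5) +
      (1853308729705810546875/32768) * (u^9 * v^4) +
      (477347064971923828125/16384) * (u^10 * v^3) +
      (164544200897216796875/16384) * (u^11 * v^2) +
      (68255901336669921875/32768) * (u^12 * v^1) +
      (6449222564697265625/32768) * (u^13 * v^0) := by positivity
  rw [hu, hv] at h
  unfold NN ph
  linarith

lemma key (m t r : ℝ) (ht : 0 ≤ t) (ht1 : t ≤ 1) (hm : m = max (Real.sqrt (1 - t^2)) (t/2))
    (hm0 : 0 < m) (hr : r = m⁻¹) : r * ph (t^2) ≤ NN (t^2) := by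
  have hy : t^2 ≤ 1 := by nlinarith
  rw [hr, inv_mul_le_iff₀ hm0]
  rcases le_total (t/2) (Real.sqrt (1 - t^2)) with h | h
  · rw [max_eq_left h] at hm
    have hz : m^2 = 1 - t^2 := by rw [hm, Real.sq_sqrt (by linarith)]
    rw [← hm] at h
    have e : t^2 = 1 - m^2 := by linarith
    have hz1 : (44/100 : ℝ) ≤ m := by nlinarith
    have hz2 : m ≤ 1 := by nlinarith
    rw [e]
    rcases le_total m (3/4) with h3 | h3
    · exact c1 m (by linarith) h3
    · exact c2 m h3 (by linarith)
  · rw [max_eq_right h] at hm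
    have hs := Real.sq_sqrt (show 0 ≤ 1 - t^2 by linarith)
    have hs0 := Real.sqrt_nonneg (1 - t^2)
    have ht2 : (89/100 : ℝ) ≤ t := by nlinarith
    rw [hm]
    rcases le_total t (92/100) with h3 | h3
    · have := c3 t (by linarith) (by linarith)
      linarith
    · have := c4 t (by linarith) (by linarith)
      linarith

noncomputable def testF (x : EE 5) : ℝ := ph ((x 4) ^ 2)

lemma testF_cont : Continuous testF := by unfold testF ph; fun_prop

lemma fin4 : (μH[4] : Measure (EE 5)) (Metric.sphere (0 : EE 5) 1) < ∞ := by
  have := sphere_fin 4; norm_num at this; exact this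

lemma pos4 : 0 < (μH[4] : Measure (EE 5)) (Metric.sphere (0 : EE 5) 1) := by
  have := sphere_pos 4; norm_num at this; exact this

lemma fin3 : (μH[3] : Measure (EE 4)) (Metric.sphere (0 : EE 4) 1) < ∞ := by
  have := sphere_fin 3; norm_num at this; exact this

lemma sec3 (w : EE 4) :
    0 ≤ ∫ x in Metric.sphere (0 : EE 4) 1, ph (⟪x, w⟫ ^ 2) ∂μH[3] := by
  have h0 := mom_coord (d := 3) (0 : Fin 4) w 0
  have h2 := mom_coord (d := 3) (0 : Fin 4) w 2
  have h4 := mom_coord (d := 3) (0 : Fin 4) w 4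
  have r0 := mom_rec fin3 0 0
  have r1 := mom_rec fin3 0 1
  have hM : 0 ≤ ∫ x in Metric.sphere (0 : EE 4) 1, (x 0) ^ 0 ∂μH[3] :=
    integral_nonneg fun x => by simp
  norm_num at r0 r1
  have e : ∫ x in Metric.sphere (0 : EE 4) 1, ph (⟪x, w⟫ ^ 2) ∂μH[3]
      = ∫ x in Metric.sphere (0 : EE 4) 1, ⟪x, w⟫ ^ 0 ∂μH[3]
      - 8 * ∫ x in Metric.sphere (0 : EE 4) 1, ⟪x, w⟫ ^ 2 ∂μH[3]
      + 8 * ∫ x in Metric.sphere (0 : EE 4) 1, ⟪x, w⟫ ^ 4 ∂μH[3] := by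
    rw [← integral_const_mul, ← integral_const_mul, ← integral_sub, ← integral_add]
    · congr 1; funext x; unfold ph; ring
    all_goals exact intOn fin3 _ (by fun_prop)
  rw [e, h0, h2, h4]
  generalize ‖w‖ = s at *
  simp only [pow_zero] at hM ⊢
  norm_num
  set a := (μH[3] : Measure (EE 4)).real (Metric.sphere (0 : EE 4) 1)
  have hM : 0 ≤ a := measureReal_nonneg
  generalize ∫ x in Metric.sphere (0 : EE 4) 1, (x 0) ^ 2 ∂μH[3] = b at *
  generalize ∫ x in Metric.sphere (0 : EE 4) 1, (x 0) ^ 4 ∂μH[3] = c at *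
  have hb : b = a / 4 := by linarith
  have hc : c = a / 8 := by linarith
  rw [hb, hc]
  nlinarith [mul_nonneg hM (sq_nonneg (s^2 - 1))]

lemma sec_nonneg (ξ : EE 5) (hξ : ‖ξ‖ = 1) :
    0 ≤ ∫ x in Metric.sphere (0 : EE 5) 1 ∩ {x : EE 5 | ⟪x, ξ⟫ = 0}, testF x ∂μH[3] := by
  have hξ0 : ξ ≠ 0 := by rintro rfl; simp at hξ
  haveI : Fact (Module.finrank ℝ (EE 5) = 4 + 1) := ⟨by simp⟩
  let B := OrthonormalBasis.fromOrthogonalSpanSingleton (𝕜 := ℝ) 4 hξ0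
  let L : EE 4 →ₗᵢ[ℝ] EE 5 :=
    ((ℝ ∙ ξ)ᗮ).subtypeₗᵢ.comp B.repr.symm.toLinearIsometry
  have hrange : range L = {x : EE 5 | ⟪x, ξ⟫ = 0} := by
    ext x
    constructor
    · rintro ⟨y, rfl⟩
      have := (B.repr.symm y).2
      rw [Submodule.mem_orthogonal_singleton_iff_inner_left] at this
      exact this
    · intro hx
      have hx' : x ∈ (ℝ ∙ ξ)ᗮ := by
        rw [Submodule.mem_orthogonal_singleton_iff_inner_left]; exact hx
      refine ⟨B.repr ⟨x, hx'⟩, ?_⟩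
      simp [L]
  have hmp : MeasurePreserving L (μH[3] : Measure (EE 4)) ((μH[3] : Measure (EE 5)).restrict (range L)) :=
    ⟨L.continuous.measurable, L.isometry.map_hausdorffMeasure (Or.inl (by norm_num))⟩
  have h := hmp.setIntegral_preimage_emb L.isometry.isClosedEmbedding.measurableEmbedding testF
    (Metric.sphere (0 : EE 5) 1)
  rw [Measure.restrict_restrict Metric.isClosed_sphere.measurableSet, hrange] at h
  rw [← h]
  have hpre : L ⁻¹' (Metric.sphere (0 : EE 5) 1) = Metric.sphere (0 : EE 4) 1 := by
    ext x; simp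
  rw [hpre]
  have hw := sec3 (L.toContinuousLinearMap.adjoint (EuclideanSpace.single 4 1))
  convert hw using 3 with x
  rw [ContinuousLinearMap.adjoint_inner_right, EuclideanSpace.inner_single_right]
  simp [testF]

lemma int_NN : ∫ x in Metric.sphere (0 : EE 5) 1, NN ((x 4) ^ 2) ∂μH[4] < 0 := by
  have r0 := mom_rec fin4 4 0
  have r1 := mom_rec fin4 4 1
  have r2 := mom_rec fin4 4 2
  have r3 := mom_rec fin4 4 3
  have r4 := mom_rec fin4 4 4
  have r5 := mom_rec fin4 4 5
  have hM : 0 < ∫ x in Metric.sphere (0 : EE 5) 1, (1:ℝ) ∂μH[4] := by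
    simp only [integral_const, smul_eq_mul, mul_one]
    simp only [Measure.real, Measure.restrict_apply_univ]
    exact ENNReal.toReal_pos pos4.ne' fin4.ne
  let m : ℕ → ℝ := fun k => ∫ x in Metric.sphere (0 : EE 5) 1, (x 4) ^ k ∂μH[4]
  have e : ∫ x in Metric.sphere (0 : EE 5) 1, NN ((x 4) ^ 2) ∂μH[4]
      = 501/500 * m 0 - 751/100*m 2 + 46/10*m 4 - 83/100*m 6 + 966/100*m 8 - 16*m 10
        + 1216/100*m 12 := by
    simp only [m]
    simp only [← integral_const_mul]
    rw [← integral_sub, ← integral_add, ← integral_sub, ← integral_add, ← integral_sub,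
      ← integral_add]
    · congr 1; funext x; unfold NN; ring
    all_goals exact intOn fin4 _ (by fun_prop)
  have hM' : 0 < m 0 := by simpa [m] using hM
  change _ * m 2 = _ * m 0 at r0
  change _ * m 4 = _ * m 2 at r1
  change _ * m 6 = _ * m 4 at r2
  change _ * m 8 = _ * m 6 at r3
  change _ * m 10 = _ * m 8 at r4
  change _ * m 12 = _ * m 10 at r5
  rw [e]
  norm_num at r0 r1 r2 r3 r4 r5
  linarith

def KK : Set (EE 5) := {x | x 0 ^ 2 + x 1 ^ 2 + x 2 ^ 2 + x 3 ^ 2 ≤ 1 ∧ |x 4| ≤ 2}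

lemma nsq (x : EE 5) : ‖x‖ ^ 2 = x 0 ^ 2 + x 1 ^ 2 + x 2 ^ 2 + x 3 ^ 2 + x 4 ^ 2 := by
  rw [EuclideanSpace.real_norm_sq_eq, Fin.sum_univ_five]

lemma KK_compact : IsCompact KK := by
  refine Metric.isCompact_of_isClosed_isBounded ?_ ?_
  · have h1 : IsClosed {x : EE 5 | x 0 ^ 2 + x 1 ^ 2 + x 2 ^ 2 + x 3 ^ 2 ≤ 1} :=
      isClosed_le (by fun_prop) (by fun_prop)
    have h2 : IsClosed {x : EE 5 | |x 4| ≤ 2} := isClosed_le (by fun_prop) (by fun_prop)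
    exact h1.inter h2
  · refine (Metric.isBounded_closedBall (x := (0 : EE 5)) (r := 3)).subset ?_
    rintro x ⟨h1, h2⟩
    rw [mem_closedBall_zero_iff]
    have := nsq x
    have h3 := abs_le.1 h2
    have : x 4 ^ 2 ≤ 4 := by nlinarith
    nlinarith [norm_nonneg x]

lemma KK_convex : Convex ℝ KK := by
  rintro x ⟨hx1, hx2⟩ y ⟨hy1, hy2⟩ a b ha hb hab
  have hc : ∀ s t : ℝ, (a * s + b * t) ^ 2 ≤ a * s ^ 2 + b * t ^ 2 := by
    intro s t
    have hb' : b = 1 - a := by linarith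
    have := mul_nonneg (mul_nonneg ha hb) (sq_nonneg (s - t))
    subst hb'
    nlinarith
  refine ⟨?_, ?_⟩
  · simp only [PiLp.add_apply, PiLp.smul_apply, smul_eq_mul]
    have := hc (x 0) (y 0)
    have := hc (x 1) (y 1)
    have := hc (x 2) (y 2)
    have := hc (x 3) (y 3)
    nlinarith
  · simp only [PiLp.add_apply, PiLp.smul_apply, smul_eq_mul]
    rw [abs_le] at *
    constructor <;> nlinarith

lemma KK_int : (interior KK).Nonempty := by
  refine ⟨0, mem_interior.2 ⟨Metric.ball 0 1, ?_, Metric.isOpen_ball, by simp⟩⟩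
  intro x hx
  rw [mem_ball_zero_iff] at hx
  have h := nsq x
  have h2 : ‖x‖ ^ 2 ≤ 1 := by nlinarith [norm_nonneg x]
  refine ⟨by nlinarith [sq_nonneg (x 4)], ?_⟩
  rw [abs_le]
  constructor <;> nlinarith [sq_nonneg (x 0), sq_nonneg (x 1), sq_nonneg (x 2), sq_nonneg (x 3)]

lemma KK_symm : KK = -KK := by
  ext x; simp [KK]

noncomputable def mm (x : EE 5) : ℝ := max (Real.sqrt (1 - |x 4| ^ 2)) (|x 4| / 2)

lemma mm_pos (x : EE 5) : 0 < mm x := by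
  unfold mm
  rcases eq_or_lt_of_le (abs_nonneg (x 4)) with h | h
  · rw [← h]; simp
  · exact lt_max_of_lt_right (by linarith)

lemma rho_eq (x : EE 5) (hx : ‖x‖ = 1) (r : ℝ) (hr : IsGreatest {a : ℝ | 0 < a ∧ a • x ∈ KK} r) :
    r = (mm x)⁻¹ := by
  refine hr.unique ?_
  have hs : x 0 ^ 2 + x 1 ^ 2 + x 2 ^ 2 + x 3 ^ 2 = 1 - |x 4| ^ 2 := by
    have := nsq x; rw [hx] at this; rw [sq_abs]; linarith
  have hnn : 0 ≤ 1 - |x 4| ^ 2 := by rw [← hs]; positivity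
  have hmem : ∀ a : ℝ, 0 < a → (a • x ∈ KK ↔ a * mm x ≤ 1) := by
    intro a ha
    unfold mm
    rw [mul_max_of_nonneg _ _ ha.le, max_le_iff]
    have h1 : a * Real.sqrt (1 - |x 4| ^ 2) ≤ 1 ↔ a ^ 2 * (1 - |x 4| ^ 2) ≤ 1 := by
      rw [← sq_le_one_iff₀ (by positivity), mul_pow, Real.sq_sqrt hnn]
    rw [h1, ← hs]
    simp only [KK, mem_ofPred_eq, PiLp.smul_apply, smul_eq_mul, abs_mul, abs_of_pos ha]
    constructor
    · rintro ⟨h, h'⟩; constructor <;> linarith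
    · rintro ⟨h, h'⟩; constructor <;> linarith
  have hm := mm_pos x
  constructor
  · refine ⟨by positivity, (hmem _ (by positivity)).2 ?_⟩
    rw [inv_mul_cancel₀ hm.ne']
  · rintro a ⟨ha, haK⟩
    have := (hmem a ha).1 haK
    rwa [← one_div, le_div_iff₀ hm]

lemma mm_cont : Continuous mm := by unfold mm; fun_prop

/-- Theorem 4: there exists an origin-symmetric convex body `K` in `ℝ⁵` that is not an
intersection body: no finite non-negative Borel measure `μ` on the sphere `S⁴`
satisfies `∫_{S⁴} ρ_K(x) f(x) dx = ∫_{S⁴} (∫_{S⁴ ∩ ξ^⊥} f(x) dx) dμ(ξ)` for every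
continuous `f`. -/
theorem exists_symmetric_convex_body_in_R5_not_intersection_body :
    ∃ K : Set (EuclideanSpace ℝ (Fin 5)),
      IsCompact K ∧ Convex ℝ K ∧ (interior K).Nonempty ∧ K = -K ∧
      ∀ ρ : EuclideanSpace ℝ (Fin 5) → ℝ,
        (∀ x : EuclideanSpace ℝ (Fin 5), ‖x‖ = 1 →
          IsGreatest {a : ℝ | 0 < a ∧ a • x ∈ K} (ρ x)) →
        ¬ ∃ μ : Measure (Metric.sphere (0 : EuclideanSpace ℝ (Fin 5)) 1),
            IsFiniteMeasure μ ∧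
            ∀ f : EuclideanSpace ℝ (Fin 5) → ℝ, Continuous f →
              ∫ x in Metric.sphere (0 : EuclideanSpace ℝ (Fin 5)) 1, ρ x * f x ∂μH[4]
                = ∫ ξ : Metric.sphere (0 : EuclideanSpace ℝ (Fin 5)) 1,
                    (∫ x in Metric.sphere (0 : EuclideanSpace ℝ (Fin 5)) 1 ∩
                        {x : EuclideanSpace ℝ (Fin 5) |
                          ⟪x, (ξ : EuclideanSpace ℝ (Fin 5))⟫ = 0},
                      f x ∂μH[3]) ∂μ := by
  refine ⟨KK, KK_compact, KK_convex, KK_int, KK_symm, ?_⟩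
  rintro ρ hρ ⟨μ, _, hμ⟩
  have h := hμ testF testF_cont
  have hR : 0 ≤ ∫ ξ : Metric.sphere (0 : EuclideanSpace ℝ (Fin 5)) 1,
      (∫ x in Metric.sphere (0 : EuclideanSpace ℝ (Fin 5)) 1 ∩
        {x : EuclideanSpace ℝ (Fin 5) | ⟪x, (ξ : EuclideanSpace ℝ (Fin 5))⟫ = 0},
          testF x ∂μH[3]) ∂μ :=
    integral_nonneg fun ξ => sec_nonneg ξ (by simpa using ξ.2)
  have hS : MeasurableSet (Metric.sphere (0 : EE 5) 1) := Metric.isClosed_sphere.measurableSet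
  have hL : ∫ x in Metric.sphere (0 : EuclideanSpace ℝ (Fin 5)) 1, ρ x * testF x ∂μH[4]
      = ∫ x in Metric.sphere (0 : EE 5) 1, (mm x)⁻¹ * testF x ∂μH[4] := by
    refine setIntegral_congr_fun hS fun x hx => ?_
    have hx1 : ‖x‖ = 1 := by simpa using hx
    simp only [rho_eq x hx1 _ (hρ x hx1)]
  have hlt : ∫ x in Metric.sphere (0 : EE 5) 1, (mm x)⁻¹ * testF x ∂μH[4]
      ≤ ∫ x in Metric.sphere (0 : EE 5) 1, NN ((x 4) ^ 2) ∂μH[4] := by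
    refine setIntegral_mono_on ?_ ?_ hS ?_
    · exact intOn fin4 _ ((mm_cont.inv₀ fun x => (mm_pos x).ne').mul testF_cont)
    · exact intOn fin4 _ (by unfold NN; fun_prop)
    · intro x hx
      have hx1 : ‖x‖ = 1 := by simpa using hx
      have h1 : |x 4| ≤ 1 := by
        have := PiLp.norm_apply_le x 4
        rw [hx1] at this; exact this
      have := key (mm x) |x 4| (mm x)⁻¹ (abs_nonneg _) h1 rfl (mm_pos x) rfl
      rwa [sq_abs] at this
  have := int_NN
  linarith
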